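/- Let π : Γ → G be a surjective group homomorphism whose kernel A = ker π is contained in the center of Γ, let s : G → Γ be a section of π with s(1_G) = 1_Γ, and let φ : A → ℝ/ℤ be a group homomorphism. Let l : ℝ/ℤ → ℝ be the unique set-theoretic section of the projection ℝ → ℝ/ℤ with values in [0,1). Define φ_s(γ) = φ(γ·(s(π(γ)))⁻¹) for γ ∈ Γ, define c̄ : G × G → ℝ/ℤ by c̄(g,h) = −φ(s(g)·s(h)·s(gh)⁻¹), and define c' : Γ × Γ → ℝ by c'(γ₁,γ₂) = l(φ_s(γ₂)) − l(φ_s(γ₁γ₂)) + l(φ_s(γ₁)) − l(c̄(π(γ₁), π(γ₂))). Then c'(γ₁,γ₂) is an integer for all γ₁, γ₂ ∈ Γ, and for all a₁, a₂ ∈ A one has c'(a₁,a₂) = l(φ(a₂)) − l(φ(a₁·a₂)) + l(φ(a₁)). -/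

import Mathlib

/-- Let `π : Γ → G` be a central extension with a normalized section `s`,
let `φ` be a homomorphism from `ker π` to `ℝ/ℤ` (modeled as a map `φ : Γ → ℝ/ℤ` additive
on `ker π`), and let `l : ℝ/ℤ → ℝ` be the section of the projection with values in `[0,1)`.
With `φ_s γ = φ (γ * (s (π γ))⁻¹)`, `c̄ g h = -φ (s g * s h * (s (g*h))⁻¹)`, and
`c' γ₁ γ₂ = l (φ_s γ₂) - l (φ_s (γ₁γ₂)) + l (φ_s γ₁) - l (c̄ (π γ₁) (π γ₂))`, the cochain
`c'` is integer-valued, and on the kernel `c' a₁ a₂ = l (φ a₂) - l (φ (a₁a₂)) + l (φ a₁)`. -/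
theorem integer_cochain_cprime {Γ G : Type*} [Group Γ] [Group G]
    (π : Γ →* G) (hsurj : Function.Surjective π)
    (hcent : π.ker ≤ Subgroup.center Γ)
    (s : G → Γ) (hs : ∀ g : G, π (s g) = g) (hs1 : s 1 = 1)
    (φ : Γ → AddCircle (1 : ℝ))
    (hφ : ∀ a b : Γ, a ∈ π.ker → b ∈ π.ker → φ (a * b) = φ a + φ b)
    (l : AddCircle (1 : ℝ) → ℝ)
    (hl_mem : ∀ x : AddCircle (1 : ℝ), l x ∈ Set.Ico (0 : ℝ) 1)
    (hl_sec : ∀ x : AddCircle (1 : ℝ), ((l x : ℝ) : AddCircle (1 : ℝ)) = x)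
    (φs : Γ → AddCircle (1 : ℝ)) (hφs : ∀ γ : Γ, φs γ = φ (γ * (s (π γ))⁻¹))
    (cbar : G → G → AddCircle (1 : ℝ))
    (hcbar : ∀ g h : G, cbar g h = -φ (s g * s h * (s (g * h))⁻¹))
    (c' : Γ → Γ → ℝ)
    (hc' : ∀ γ₁ γ₂ : Γ,
      c' γ₁ γ₂ = l (φs γ₂) - l (φs (γ₁ * γ₂)) + l (φs γ₁) - l (cbar (π γ₁) (π γ₂))) :
    (∀ γ₁ γ₂ : Γ, ∃ n : ℤ, c' γ₁ γ₂ = (n : ℝ)) ∧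
    (∀ a₁ a₂ : Γ, a₁ ∈ π.ker → a₂ ∈ π.ker →
      c' a₁ a₂ = l (φ a₂) - l (φ (a₁ * a₂)) + l (φ a₁)) := by
  have coe_eq_zero {x : ℝ} (h : (x : AddCircle (1 : ℝ)) = 0) : ∃ n : ℤ, x = (n : ℝ) := by
    obtain ⟨n, hn⟩ := (AddCircle.coe_eq_zero_iff (1 : ℝ)).mp h
    exact ⟨n, by simpa using hn.symm⟩
  have φ_one : φ 1 = 0 := by
    simpa using hφ 1 1 (one_mem _) (one_mem _)
  have l_zero : l 0 = 0 := by
    obtain ⟨n, hn⟩ := coe_eq_zero (hl_sec 0)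
    obtain ⟨h0, h1⟩ := hl_mem 0
    rw [hn] at h0 h1 ⊢
    have h0' : 0 ≤ n := by exact_mod_cast h0
    have h1' : n < 1 := by exact_mod_cast h1
    have : n = 0 := by omega
    simp [this]
  have φs_mul (γ₁ γ₂ : Γ) :
      φs (γ₁ * γ₂) = φs γ₁ + φs γ₂ - cbar (π γ₁) (π γ₂) := by
    have mem (γ : Γ) : γ * (s (π γ))⁻¹ ∈ π.ker := by
      simp [MonoidHom.mem_ker, hs]
    have mem_cocycle : s (π γ₁) * s (π γ₂) * (s (π γ₁ * π γ₂))⁻¹ ∈ π.ker := by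
      simp [MonoidHom.mem_ker, hs]
    have comm := Subgroup.mem_center_iff.mp (hcent (mem γ₂)) (s (π γ₁))
    have factor : γ₁ * γ₂ * (s (π (γ₁ * γ₂)))⁻¹ =
        γ₁ * (s (π γ₁))⁻¹ * (γ₂ * (s (π γ₂))⁻¹) *
          (s (π γ₁) * s (π γ₂) * (s (π γ₁ * π γ₂))⁻¹) := by
      calc
        _ = γ₁ * (s (π γ₁))⁻¹ * (s (π γ₁) * (γ₂ * (s (π γ₂))⁻¹)) *
            (s (π γ₂) * (s (π γ₁ * π γ₂))⁻¹) := by rw [map_mul]; group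
        _ = _ := by rw [comm]; group
    rw [hφs (γ₁ * γ₂), factor, hφ _ _ (mul_mem (mem γ₁) (mem γ₂)) mem_cocycle,
      hφ _ _ (mem γ₁) (mem γ₂), hφs, hφs, hcbar, sub_neg_eq_add]
  refine ⟨fun γ₁ γ₂ => coe_eq_zero ?_, fun a₁ a₂ h₁ h₂ => ?_⟩
  · rw [hc', AddCircle.coe_sub, AddCircle.coe_add, AddCircle.coe_sub]
    simp only [hl_sec, φs_mul]
    abel
  · have φs_ker {a : Γ} (ha : a ∈ π.ker) : φs a = φ a := by
      rw [hφs, MonoidHom.mem_ker.mp ha, hs1, inv_one, mul_one]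
    rw [hc', φs_ker h₁, φs_ker h₂, φs_ker (mul_mem h₁ h₂), MonoidHom.mem_ker.mp h₁,
      MonoidHom.mem_ker.mp h₂, hcbar]
    simp [hs1, φ_one, l_zero]
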